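/- Let d ≥ 1, N ∈ ℕ, κ ∈ ℝ^{d+1} with each κ_i > −1, and let n ≤ N. Then for every ν ∈ ℕ^d with |ν| = n and every x ∈ Z_N^{d+1}, the Hahn polynomial H_ν expands in monic Hahn polynomials as H_ν(x; κ, N) = ((−1)^n n! / (−N)_n) · Σ_{α ∈ Z_n^{d+1}} (H_ν(α; κ, n) / α!) · Q_α(x; κ, N). -/

import Mathlib

open Finset

/-- Pochhammer symbol `(a)_k = a (a+1) ⋯ (a+k-1)`. -/
noncomputable def poch (a : ℝ) : ℕ → ℝ
  | 0 => 1
  | k + 1 => poch a k * (a + k)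

/-- Multi-index Pochhammer `(x)_γ = ∏ i (x i)_{γ i}`. -/
noncomputable def pochV {m : ℕ} (x : Fin m → ℝ) (γ : Fin m → ℕ) : ℝ :=
  ∏ i, poch (x i) (γ i)

/-- Multi-index factorial `γ! = ∏ i (γ i)!` (as a real number). -/
noncomputable def mfact {m : ℕ} (γ : Fin m → ℕ) : ℝ :=
  ∏ i, (Nat.factorial (γ i) : ℝ)

/-- Shifted monomial `m_γ(x) = (-1)^{|γ|} (-x)_γ`. -/
noncomputable def mono {m : ℕ} (γ : Fin m → ℕ) (x : Fin m → ℝ) : ℝ :=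
  (-1 : ℝ) ^ (∑ i, γ i) * pochV (fun i => -(x i)) γ

/-- `Z_N^{d+1} = {α ∈ ℕ^{d+1} : |α| = N}` as a finite set. -/
def ZN (d N : ℕ) : Finset (Fin (d + 1) → ℕ) :=
  (Fintype.piFinset fun _ => Finset.range (N + 1)).filter fun α => ∑ i, α i = N

/-- `{ν ∈ ℕ^d : |ν| = n}` as a finite set. -/
def idxSet (d n : ℕ) : Finset (Fin d → ℕ) :=
  (Fintype.piFinset fun _ => Finset.range (n + 1)).filter fun ν => ∑ i, ν i = n

/-- The finite set `{γ ∈ ℕ^m : γ ≤ α}`. -/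
def below {m : ℕ} (α : Fin m → ℕ) : Finset (Fin m → ℕ) :=
  Fintype.piFinset fun i => Finset.range (α i + 1)

/-- Monic Hahn polynomial `Q_α(x; κ, N)`. -/
noncomputable def monicQ (d N : ℕ) (κ : Fin (d + 1) → ℝ) (α : Fin (d + 1) → ℕ)
    (x : Fin (d + 1) → ℝ) : ℝ :=
  poch (-(N : ℝ)) (∑ i, α i) * pochV (fun i => κ i + 1) α /
      poch ((∑ i, κ i) + d + (∑ i, α i)) (∑ i, α i) *
    ∑ γ ∈ below α,
      pochV (fun i => -(α i : ℝ)) γ * poch ((∑ i, κ i) + d + (∑ i, α i)) (∑ i, γ i) *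
          (-1 : ℝ) ^ (∑ i, γ i) /
          (mfact γ * pochV (fun i => κ i + 1) γ * poch (-(N : ℝ)) (∑ i, γ i)) *
        mono γ x

/-- One-variable Hahn polynomial `Q_n(x; a, b, M)` (a `₃F₂` sum). -/
noncomputable def hahn1 (n : ℕ) (x a b M : ℝ) : ℝ :=
  ∑ k ∈ Finset.range (n + 1),
    poch (-(n : ℝ)) k * poch ((n : ℝ) + a + b + 1) k * poch (-x) k /
      (poch (a + 1) k * poch (-M) k * (Nat.factorial k : ℝ))

/-- The parameter `a_j = κ_{j+1}+⋯+κ_{d+1} + 2|ν^{j+1}| + d - j` (1-based `j`). -/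
noncomputable def aj (d : ℕ) (κ : Fin (d + 1) → ℝ) (ν : Fin d → ℕ) (j : Fin d) : ℝ :=
  (∑ i ∈ Finset.univ.filter (fun i : Fin (d + 1) => (j : ℕ) < (i : ℕ)), κ i) +
    2 * (∑ i ∈ Finset.univ.filter (fun i : Fin d => (j : ℕ) < (i : ℕ)), (ν i : ℝ)) +
    ((d - 1 - (j : ℕ) : ℕ) : ℝ)

/-- `|x_{j-1}| = x_1 + ⋯ + x_{j-1}` (1-based `j`). -/
noncomputable def sumLt (d : ℕ) (x : Fin (d + 1) → ℕ) (j : Fin d) : ℝ :=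
  ∑ i ∈ Finset.univ.filter (fun i : Fin (d + 1) => (i : ℕ) < (j : ℕ)), (x i : ℝ)

/-- `|ν^{j+1}| = ν_{j+1} + ⋯ + ν_d` (1-based `j`). -/
noncomputable def sumGt (d : ℕ) (ν : Fin d → ℕ) (j : Fin d) : ℝ :=
  ∑ i ∈ Finset.univ.filter (fun i : Fin d => (j : ℕ) < (i : ℕ)), (ν i : ℝ)

/-- Hahn polynomial of `d` variables `H_ν(x; κ, N)`. -/
noncomputable def hahnH (d N : ℕ) (κ : Fin (d + 1) → ℝ) (ν : Fin d → ℕ)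
    (x : Fin (d + 1) → ℕ) : ℝ :=
  (-1 : ℝ) ^ (∑ i, ν i) / poch (-(N : ℝ)) (∑ i, ν i) *
    ∏ j : Fin d,
      poch (κ j.castSucc + 1) (ν j) / poch (aj d κ ν j + 1) (ν j) *
        poch (-(N : ℝ) + sumLt d x j + sumGt d ν j) (ν j) *
        hahn1 (ν j) (x j.castSucc : ℝ) (κ j.castSucc) (aj d κ ν j)
          ((N : ℝ) - sumLt d x j - sumGt d ν j)

/-- Squared norm `B_ν(κ, N)` of the Hahn polynomial `H_ν(·; κ, N)`. -/
noncomputable def Bnorm (d N : ℕ) (κ : Fin (d + 1) → ℝ) (ν : Fin d → ℕ) : ℝ :=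
  (-1 : ℝ) ^ (∑ i, ν i) * poch ((∑ i, κ i) + d + 1) (N + ∑ i, ν i) /
      (poch (-(N : ℝ)) (∑ i, ν i) * poch ((∑ i, κ i) + d + 1) N *
        poch ((∑ i, κ i) + d + 1) (2 * ∑ i, ν i)) *
    ∏ j : Fin d,
      poch (κ j.castSucc + aj d κ ν j + 1) (2 * ν j) * poch (κ j.castSucc + 1) (ν j) *
          (Nat.factorial (ν j) : ℝ) /
        (poch (κ j.castSucc + aj d κ ν j + 1) (ν j) * poch (aj d κ ν j + 1) (ν j))

/-- Projection `Q_{α,n}(x; κ, N)` of `m_α/(κ+1)_α` onto the space of degree `n`. -/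
noncomputable def monicQn (d N : ℕ) (κ : Fin (d + 1) → ℝ) (α : Fin (d + 1) → ℕ) (n : ℕ)
    (x : Fin (d + 1) → ℝ) : ℝ :=
  (-1 : ℝ) ^ (∑ i, α i) * poch (-(N : ℝ)) (∑ i, α i) * poch ((∑ i, κ i) + d + 1) (2 * n) /
      (poch (-(N : ℝ)) n * poch ((∑ i, κ i) + d + 1) ((∑ i, α i) + n)) *
    ∑ β ∈ ZN d n,
      pochV (fun i => -(α i : ℝ)) β / (mfact β * pochV (fun i => κ i + 1) β) *
        monicQ d N κ β x

/-- The kernel `E_k(x, y; κ) = Σ_{|γ|=k} (-x)_γ (-y)_γ / (γ! (κ+1)_γ)`. -/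
noncomputable def Efun (d : ℕ) (κ : Fin (d + 1) → ℝ) (x y : Fin (d + 1) → ℕ) (k : ℕ) : ℝ :=
  ∑ γ ∈ ZN d k,
    pochV (fun i => -(x i : ℝ)) γ * pochV (fun i => -(y i : ℝ)) γ /
      (mfact γ * pochV (fun i => κ i + 1) γ)

/-- Monic Jacobi polynomial on the simplex `R_α^κ(x)`. -/
noncomputable def jacobiR (d : ℕ) (κ : Fin (d + 1) → ℝ) (α : Fin (d + 1) → ℕ)
    (x : Fin d → ℝ) : ℝ :=
  (-1 : ℝ) ^ (∑ i, α i) * pochV (fun i => κ i + 1) α /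
      poch ((∑ i, κ i) + d + (∑ i, α i)) (∑ i, α i) *
    ∑ γ ∈ below α,
      pochV (fun i => -(α i : ℝ)) γ * poch ((∑ i, κ i) + d + (∑ i, α i)) (∑ i, γ i) /
          (pochV (fun i => κ i + 1) γ * mfact γ) *
        ∏ i, (Fin.snoc x (1 - ∑ i, x i) : Fin (d + 1) → ℝ) i ^ γ i

/-- One-variable Krawtchouk polynomial `K_n(x; p, M)`. -/
noncomputable def kraw1 (n : ℕ) (x p M : ℝ) : ℝ :=
  ∑ k ∈ Finset.range (n + 1),
    poch (-(n : ℝ)) k * poch (-x) k / (poch (-M) k * (Nat.factorial k : ℝ) * p ^ k)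

/-- The extended parameter `𝛒 = (ρ_1, …, ρ_d, 1 - |ρ|)`. -/
noncomputable def brho (d : ℕ) (ρ : Fin d → ℝ) : Fin (d + 1) → ℝ :=
  Fin.snoc ρ (1 - ∑ i, ρ i)

/-- `𝛒^γ = ∏ i 𝛒_i^{γ i}`. -/
noncomputable def bpow (d : ℕ) (ρ : Fin d → ℝ) (γ : Fin (d + 1) → ℕ) : ℝ :=
  ∏ i, brho d ρ i ^ γ i

/-- `|𝛒_j| = ρ_1 + ⋯ + ρ_j` (1-based `j`). -/
noncomputable def sumLe (d : ℕ) (ρ : Fin d → ℝ) (j : Fin d) : ℝ :=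
  ∑ i ∈ Finset.univ.filter (fun i : Fin d => (i : ℕ) ≤ (j : ℕ)), ρ i

/-- `|𝛒_{j-1}| = ρ_1 + ⋯ + ρ_{j-1}` (1-based `j`). -/
noncomputable def sumLtρ (d : ℕ) (ρ : Fin d → ℝ) (j : Fin d) : ℝ :=
  ∑ i ∈ Finset.univ.filter (fun i : Fin d => (i : ℕ) < (j : ℕ)), ρ i

/-- Krawtchouk polynomial of `d` variables `K_ν(x; ρ, N)`. -/
noncomputable def krawH (d N : ℕ) (ρ : Fin d → ℝ) (ν : Fin d → ℕ)
    (x : Fin (d + 1) → ℕ) : ℝ :=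
  (-1 : ℝ) ^ (∑ i, ν i) / poch (-(N : ℝ)) (∑ i, ν i) *
    ∏ j : Fin d,
      ρ j ^ ν j / (1 - sumLe d ρ j) ^ ν j *
        poch (-(N : ℝ) + sumLt d x j + sumGt d ν j) (ν j) *
        kraw1 (ν j) (x j.castSucc : ℝ) (ρ j / (1 - sumLtρ d ρ j))
          ((N : ℝ) - sumLt d x j - sumGt d ν j)

/-- Squared norm `C_ν(ρ, N)` of the Krawtchouk polynomial `K_ν(·; ρ, N)`. -/
noncomputable def Cnorm (d N : ℕ) (ρ : Fin d → ℝ) (ν : Fin d → ℕ) : ℝ :=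
  (-1 : ℝ) ^ (∑ i, ν i) / (poch (-(N : ℝ)) (∑ i, ν i) * (Nat.factorial N : ℝ)) *
    ∏ j : Fin d,
      (Nat.factorial (ν j) : ℝ) * ρ j ^ ν j /
        (1 - sumLe d ρ j) ^ ((ν j : ℤ) - ((Fin.snoc ν 0 : Fin (d + 1) → ℕ) j.succ : ℤ))

/-- Monic Krawtchouk polynomial `L_α(x; ρ, N)`. -/
noncomputable def monicL (d N : ℕ) (ρ : Fin d → ℝ) (α : Fin (d + 1) → ℕ)
    (x : Fin (d + 1) → ℝ) : ℝ :=
  poch (-(N : ℝ)) (∑ i, α i) * bpow d ρ α *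
    ∑ γ ∈ below α,
      pochV (fun i => -(α i : ℝ)) γ * (-1 : ℝ) ^ (∑ i, γ i) /
          (mfact γ * poch (-(N : ℝ)) (∑ i, γ i) * bpow d ρ γ) *
        mono γ x

/-- Projection `L_{α,n}(x; ρ, N)` of `m_α/𝛒^α` onto the space of degree `n`. -/
noncomputable def monicLn (d N : ℕ) (ρ : Fin d → ℝ) (α : Fin (d + 1) → ℕ) (n : ℕ)
    (x : Fin (d + 1) → ℝ) : ℝ :=
  (-1 : ℝ) ^ (∑ i, α i) * poch (-(N : ℝ)) (∑ i, α i) / poch (-(N : ℝ)) n *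
    ∑ β ∈ ZN d n,
      pochV (fun i => -(α i : ℝ)) β / (mfact β * bpow d ρ β) * monicL d N ρ β x

/-- The kernel `F_k(x, y; ρ) = Σ_{|γ|=k} (-x)_γ (-y)_γ / (γ! 𝛒^γ)`. -/
noncomputable def Ffun (d : ℕ) (ρ : Fin d → ℝ) (x y : Fin (d + 1) → ℕ) (k : ℕ) : ℝ :=
  ∑ γ ∈ ZN d k,
    pochV (fun i => -(x i : ℝ)) γ * pochV (fun i => -(y i : ℝ)) γ / (mfact γ * bpow d ρ γ)

theorem poch_succ (a : ℝ) (k : ℕ) : poch a (k + 1) = poch a k * (a + k) := rfl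

theorem poch_add (a : ℝ) (k l : ℕ) : poch a (k + l) = poch a k * poch (a + k) l := by
  induction l with
  | zero => simp [poch]
  | succ l ih => rw [← add_assoc, poch_succ, ih, poch_succ]; push_cast; ring

theorem poch_pos {a : ℝ} (ha : 0 < a) (k : ℕ) : 0 < poch a k := by
  induction k with
  | zero => simp [poch]
  | succ k ih => rw [poch_succ]; positivity

theorem poch_neg_natCast_eq_zero {b k : ℕ} (h : b < k) : poch (-(b : ℝ)) k = 0 := by
  obtain ⟨c, rfl⟩ : ∃ c, k = b + 1 + c := ⟨k - (b + 1), by lia⟩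
  rw [poch_add, poch_succ]
  simp

theorem poch_neg_natCast_ne_zero {b k : ℕ} (h : k ≤ b) : poch (-(b : ℝ)) k ≠ 0 := by
  induction k with
  | zero => simp [poch]
  | succ k ih =>
    rw [poch_succ]
    have : (k : ℝ) < b := by exact_mod_cast h
    exact mul_ne_zero (ih (by lia)) (by linarith)

theorem poch_neg_succ_mul (b : ℝ) (g : ℕ) :
    poch (-(b + 1)) g * (b + 1 - g) = (b + 1) * poch (-b) g := by
  induction g with
  | zero => simp [poch]
  | succ g ih =>
    rw [poch_succ, poch_succ]
    push_cast
    linear_combination (-b + g) * ih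

theorem poch_neg_natCast_self (n : ℕ) :
    poch (-(n : ℝ)) n = (-1 : ℝ) ^ n * (n.factorial : ℝ) := by
  induction n with
  | zero => simp [poch]
  | succ n ih =>
    have := poch_neg_succ_mul (n : ℝ) n
    rw [poch_succ, Nat.factorial_succ]
    push_cast
    rw [pow_succ]
    linear_combination (-1 : ℝ) * this - (n + 1 : ℝ) * ih

theorem prod_mul_eq_prod_mul_of_eq_off {ι : Type*} [Fintype ι] [DecidableEq ι] {f g : ι → ℝ} (i : ι)
    {c e : ℝ} (hfg : ∀ k, k ≠ i → f k = g k) (hi : f i * c = g i * e) :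
    (∏ k, f k) * c = (∏ k, g k) * e := by
  rw [← Finset.mul_prod_erase univ f (mem_univ i), ← Finset.mul_prod_erase univ g (mem_univ i),
    Finset.prod_congr rfl fun k hk => hfg k (Finset.ne_of_mem_erase hk)]
  linear_combination (∏ k ∈ univ.erase i, g k) * hi

section Functionals

open MvPolynomial

variable {m : ℕ}

theorem pochV_neg_natCast_eq_zero {α γ : Fin m → ℕ} {i : Fin m} (h : α i < γ i) :
    pochV (fun i => -(α i : ℝ)) γ = 0 :=
  Finset.prod_eq_zero (mem_univ i) (poch_neg_natCast_eq_zero h)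

theorem pochV_add_single (y : Fin m → ℝ) (γ : Fin m →₀ ℕ) (i : Fin m) (k : ℕ) :
    pochV y ⇑(γ + Finsupp.single i k) = pochV y γ * poch (y i + γ i) k := by
  rw [← mul_one (pochV y ⇑(γ + _))]
  refine prod_mul_eq_prod_mul_of_eq_off i (fun j hj => ?_) ?_
  · simp [hj.symm]
  · simp [poch_add]

theorem pochV_neg_natCast_self (α : Fin m → ℕ) :
    pochV (fun i => -(α i : ℝ)) α = (-1 : ℝ) ^ (∑ i, α i) * mfact α := by
  simp [pochV, mfact, poch_neg_natCast_self, Finset.prod_mul_distrib, Finset.prod_pow_eq_pow_sum]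

/-- The linear functional on polynomials with prescribed values on monomials. -/
noncomputable def monomialFunctional (v : (Fin m →₀ ℕ) → ℝ) : MvPolynomial (Fin m) ℝ →ₗ[ℝ] ℝ :=
  (basisMonomials (Fin m) ℝ).constr ℝ v

theorem monomialFunctional_monomial (v : (Fin m →₀ ℕ) → ℝ) (γ : Fin m →₀ ℕ) (c : ℝ) :
    monomialFunctional v (monomial γ c) = c * v γ := by
  have h : (monomial γ c : MvPolynomial (Fin m) ℝ) = c • basisMonomials (Fin m) ℝ γ := by
    simp [smul_monomial]
  rw [h, map_smul, monomialFunctional, Module.Basis.constr_basis, smul_eq_mul]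

theorem linearMap_eq_of_support {φ ψ : MvPolynomial (Fin m) ℝ →ₗ[ℝ] ℝ}
    {P : MvPolynomial (Fin m) ℝ}
    (h : ∀ γ ∈ P.support, φ (monomial γ 1) = ψ (monomial γ 1)) : φ P = ψ P := by
  rw [P.as_sum, map_sum, map_sum]
  refine Finset.sum_congr rfl fun γ hγ => ?_
  have e : (monomial γ (coeff γ P) : MvPolynomial (Fin m) ℝ) = coeff γ P • monomial γ 1 := by
    simp [smul_monomial]
  rw [e, map_smul, map_smul, h γ hγ]

theorem sum_eq_of_mem_support {P : MvPolynomial (Fin m) ℝ} {n : ℕ} (hP : P.IsHomogeneous n)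
    {γ : Fin m →₀ ℕ} (hγ : γ ∈ P.support) : ∑ i, γ i = n := by
  have h := hP (mem_support_iff.1 hγ)
  rwa [Finsupp.weight_apply, Finsupp.sum_fintype _ _ (by simp),
    Finset.sum_congr rfl (fun i _ => by simp : ∀ i ∈ univ, _ = γ i)] at h

/-- The umbral functional `t ^ γ ↦ (-x)_γ`. -/
noncomputable def umbral (x : Fin m → ℝ) : MvPolynomial (Fin m) ℝ →ₗ[ℝ] ℝ :=
  monomialFunctional fun γ => pochV (fun i => -(x i)) γ

theorem umbral_one (x : Fin m → ℝ) : umbral x 1 = 1 := by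
  have : (1 : MvPolynomial (Fin m) ℝ) = monomial 0 1 := rfl
  rw [this, umbral, monomialFunctional_monomial]
  simp [pochV, poch]

theorem umbral_X_pow_mul (x : Fin m → ℝ) {P : MvPolynomial (Fin m) ℝ} {i : Fin m}
    (hi : i ∉ P.vars) (k : ℕ) : umbral x (X i ^ k * P) = poch (-(x i)) k * umbral x P := by
  refine linearMap_eq_of_support (φ := umbral x ∘ₗ LinearMap.mulLeft ℝ (X i ^ k))
    (ψ := poch (-(x i)) k • umbral x) fun γ hγ => ?_
  have h0 : γ i = 0 := mem_support_notMem_vars_zero hγ hi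
  simp only [LinearMap.comp_apply, LinearMap.mulLeft_apply, LinearMap.smul_apply, smul_eq_mul,
    X_pow_eq_monomial, monomial_mul, umbral, monomialFunctional_monomial]
  rw [add_comm, pochV_add_single, h0]
  simp
  ring

theorem umbral_sum_X_mul (x : Fin m → ℝ) {P : MvPolynomial (Fin m) ℝ} {s : Finset (Fin m)} {n : ℕ}
    (hs : P ∈ supported ℝ (s : Set (Fin m))) (hP : P.IsHomogeneous n) :
    umbral x ((∑ i ∈ s, X i) * P) = (n - ∑ i ∈ s, x i) * umbral x P := by
  refine linearMap_eq_of_support (φ := umbral x ∘ₗ LinearMap.mulLeft ℝ (∑ i ∈ s, X i))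
    (ψ := ((n : ℝ) - ∑ i ∈ s, x i) • umbral x) fun γ hγ => ?_
  have hn : ∑ i ∈ s, γ i = n := by
    rw [← sum_eq_of_mem_support hP hγ]
    exact Finset.sum_subset (subset_univ _) fun i _ hi =>
      mem_support_notMem_vars_zero hγ fun h => hi (mem_supported.1 hs h)
  simp only [LinearMap.comp_apply, LinearMap.mulLeft_apply, LinearMap.smul_apply, smul_eq_mul,
    Finset.sum_mul, map_sum, X, monomial_mul, umbral, monomialFunctional_monomial]
  rw [← hn, Nat.cast_sum, ← Finset.sum_sub_distrib, Finset.sum_mul]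
  refine Finset.sum_congr rfl fun i _ => ?_
  rw [add_comm, pochV_add_single]
  simp [poch]
  ring

theorem umbral_sum_X_pow_mul (x : Fin m → ℝ) {P : MvPolynomial (Fin m) ℝ} {s : Finset (Fin m)}
    {n : ℕ} (hs : P ∈ supported ℝ (s : Set (Fin m))) (hP : P.IsHomogeneous n) (b : ℕ) :
    umbral x ((∑ i ∈ s, X i) ^ b * P) = poch (n - ∑ i ∈ s, x i) b * umbral x P := by
  have hZs : (∑ i ∈ s, X i : MvPolynomial (Fin m) ℝ) ∈ supported ℝ (s : Set (Fin m)) :=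
    Subalgebra.sum_mem _ fun i hi => X_mem_supported.2 hi
  have hZh : (∑ i ∈ s, X i : MvPolynomial (Fin m) ℝ).IsHomogeneous 1 :=
    IsHomogeneous.sum _ _ _ fun i _ => isHomogeneous_X _ _
  induction b with
  | zero => simp [poch]
  | succ b ih =>
    rw [pow_succ', mul_assoc, umbral_sum_X_mul x (Subalgebra.mul_mem _ (Subalgebra.pow_mem _ hZs b) hs)
      ((hZh.pow b).mul hP), ih, poch_succ]
    push_cast
    ring

/-- The operator `∑ i, (t_i ∂_i² + (κ_i + 1) ∂_i)`. -/
noncomputable def laguerreOp (κ : Fin m → ℝ) :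
    MvPolynomial (Fin m) ℝ →ₗ[ℝ] MvPolynomial (Fin m) ℝ :=
  ∑ i, (LinearMap.mulLeft ℝ (X i) ∘ₗ (pderiv i).toLinearMap ∘ₗ (pderiv i).toLinearMap +
    (κ i + 1) • (pderiv i).toLinearMap)

theorem laguerreOp_apply (κ : Fin m → ℝ) (P : MvPolynomial (Fin m) ℝ) :
    laguerreOp κ P = ∑ i, (X i * pderiv i (pderiv i P) + C (κ i + 1) * pderiv i P) := by
  simp [laguerreOp, smul_eq_C_mul]

theorem laguerreOp_monomial (κ : Fin m → ℝ) (α : Fin m →₀ ℕ) :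
    laguerreOp κ (monomial α 1) =
      ∑ i, monomial (α - Finsupp.single i 1) ((α i : ℝ) * (α i + κ i)) := by
  rw [laguerreOp_apply]
  refine Finset.sum_congr rfl fun i _ => ?_
  simp only [pderiv_monomial, X, C_mul_monomial, monomial_mul]
  by_cases h : 2 ≤ α i
  · have e : Finsupp.single i 1 + (α - Finsupp.single i 1 - Finsupp.single i 1) =
        α - Finsupp.single i 1 := by
      ext k
      by_cases hk : k = i
      · subst hk; simp; lia
      · simp [Ne.symm hk]
    rw [e, ← map_add]
    congr 1
    simp
    rw [Nat.cast_sub (by lia)]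
    push_cast
    ring
  · have e : (α i : ℝ) * ((α - Finsupp.single i 1 : Fin m →₀ ℕ) i : ℝ) = 0 := by
      rcases (by lia : α i = 0 ∨ α i = 1) with h | h <;> simp [h]
    rw [one_mul, one_mul, e, map_zero, zero_add]
    congr 1
    rcases (by lia : α i = 0 ∨ α i = 1) with h | h <;> simp [h]
    ring

/-- The functional `t ^ α ↦ (κ + 1)_α (-α)_γ`. -/
noncomputable def weightFunctional (κ : Fin m → ℝ) (γ : Fin m → ℕ) :
    MvPolynomial (Fin m) ℝ →ₗ[ℝ] ℝ :=
  monomialFunctional fun α => pochV (fun i => κ i + 1) α * pochV (fun i => -(α i : ℝ)) γ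

theorem weightFunctional_laguerreOp (κ : Fin m → ℝ) (γ : Fin m → ℕ) {P : MvPolynomial (Fin m) ℝ}
    {n : ℕ} (hP : P.IsHomogeneous n) :
    weightFunctional κ γ (laguerreOp κ P) = (n - ∑ i, (γ i : ℝ)) * weightFunctional κ γ P := by
  refine linearMap_eq_of_support (φ := weightFunctional κ γ ∘ₗ laguerreOp κ)
    (ψ := ((n : ℝ) - ∑ i, (γ i : ℝ)) • weightFunctional κ γ) fun α hα => ?_
  have hn := sum_eq_of_mem_support hP hα
  simp only [LinearMap.comp_apply, LinearMap.smul_apply, smul_eq_mul, laguerreOp_monomial,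
    map_sum, weightFunctional, monomialFunctional_monomial]
  rw [← hn, Nat.cast_sum, ← Finset.sum_sub_distrib, Finset.sum_mul]
  refine Finset.sum_congr rfl fun i _ => ?_
  by_cases h : α i = 0
  · by_cases hg : γ i = 0
    · simp [h, hg]
    · rw [pochV_neg_natCast_eq_zero (i := i) (α := α) (by lia)]
      simp [h]
  · obtain ⟨β, rfl⟩ : ∃ β, α = β + Finsupp.single i 1 :=
      ⟨α - Finsupp.single i 1, (tsub_add_cancel_of_le (by simpa [Nat.one_le_iff_ne_zero] using h)).symm⟩
    have h1 : pochV (fun k => -((β + Finsupp.single i 1 : Fin m →₀ ℕ) k : ℝ)) γ *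
          ((β i : ℝ) + 1 - γ i) = pochV (fun k => -(β k : ℝ)) γ * (β i + 1) := by
      refine prod_mul_eq_prod_mul_of_eq_off i (fun k hk => ?_) ?_
      · simp [hk.symm]
      · have := poch_neg_succ_mul (β i : ℝ) (γ i)
        simp only [Finsupp.add_apply, Finsupp.single_eq_same]
        push_cast
        linear_combination this
    rw [add_tsub_cancel_right, pochV_add_single]
    simp only [Finsupp.add_apply, Finsupp.single_eq_same, poch] at h1 ⊢
    push_cast at h1 ⊢
    linear_combination (-(pochV (fun i => κ i + 1) β * (κ i + 1 + β i))) * h1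

end Functionals

section Harmonic

open MvPolynomial

variable {d : ℕ}

/-- The coordinates with index at least `j`. -/
def tailSet (d j : ℕ) : Finset (Fin (d + 1)) := univ.filter fun i => j ≤ (i : ℕ)

/-- The sum of the variables with index at least `j`. -/
noncomputable def tailSum (d j : ℕ) : MvPolynomial (Fin (d + 1)) ℝ := ∑ i ∈ tailSet d j, X i

theorem tailSum_mem_supported (j : ℕ) :
    tailSum d j ∈ supported ℝ (tailSet d j : Set (Fin (d + 1))) :=
  Subalgebra.sum_mem _ fun _ hi => X_mem_supported.2 hi

theorem tailSum_isHomogeneous (j : ℕ) : (tailSum d j).IsHomogeneous 1 :=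
  IsHomogeneous.sum _ _ _ fun i _ => isHomogeneous_X _ i

theorem pderiv_tailSum (i : Fin (d + 1)) (j : ℕ) :
    pderiv i (tailSum d j) = C (if j ≤ (i : ℕ) then 1 else 0) := by
  simp [tailSum, map_sum, pderiv_X, Pi.single_apply, tailSet]

theorem X_mem_tail (j : Fin d) :
    (X j.castSucc : MvPolynomial (Fin (d + 1)) ℝ) ∈
      supported ℝ (tailSet d j : Set (Fin (d + 1))) :=
  X_mem_supported.2 (by simp [tailSet])

theorem mul_X_pow_pred_pred (a : ℕ) (s : MvPolynomial (Fin (d + 1)) ℝ) :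
    s * ((a : MvPolynomial (Fin (d + 1)) ℝ) * ((a - 1 : ℕ) : MvPolynomial (Fin (d + 1)) ℝ) *
      s ^ (a - 1 - 1)) = a * (a - 1) * s ^ (a - 1) := by
  rcases a with _ | _ | a
  · simp
  · simp
  · simp; ring

theorem laguerreOp_X_pow_mul_tailSum_pow_mul (κ : Fin (d + 1) → ℝ) (j : Fin d)
    {B : MvPolynomial (Fin (d + 1)) ℝ} {n : ℕ} (hB : B.IsHomogeneous n)
    (hs : B ∈ supported ℝ (tailSet d (j + 1) : Set (Fin (d + 1)))) (hL : laguerreOp κ B = 0)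
    (a b : ℕ) :
    laguerreOp κ (X j.castSucc ^ a * tailSum d j ^ b * B) =
      (C ((a : ℝ) * (a + κ j.castSucc)) * (X j.castSucc ^ (a - 1) * tailSum d j ^ b) +
        C ((b : ℝ) * (2 * a + b - 1 + ∑ i ∈ tailSet d j, (κ i + 1) + 2 * n)) *
          (X j.castSucc ^ a * tailSum d j ^ (b - 1))) * B := by
  set s : MvPolynomial (Fin (d + 1)) ℝ := X j.castSucc with hs_def
  set z := tailSum d j with hz_def
  have hB0 : ∀ i : Fin (d + 1), (i : ℕ) ≤ j → pderiv i B = 0 := fun i hi =>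
    pderiv_eq_zero_of_notMem_vars fun h => by
      have := mem_supported.1 hs h
      simp [tailSet] at this
      lia
  let e : Fin (d + 1) → MvPolynomial (Fin (d + 1)) ℝ := fun i => if i = j.castSucc then 1 else 0
  let f : Fin (d + 1) → MvPolynomial (Fin (d + 1)) ℝ := fun i => if (j : ℕ) ≤ i then 1 else 0
  have hds : ∀ i, pderiv i s = e i := fun i => by
    simp [hs_def, e, pderiv_X, Pi.single_apply, eq_comm]
  have hdz : ∀ i, pderiv i z = f i := fun i => by
    rw [hz_def, pderiv_tailSum]; simp only [f]; split_ifs <;> simp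
  have hde : ∀ i k, pderiv k (e i) = 0 := fun i k => by simp only [e]; split_ifs <;> simp
  have hdf : ∀ i k, pderiv k (f i) = 0 := fun i k => by simp only [f]; split_ifs <;> simp
  have hee : ∀ i, e i * e i = e i := fun i => by simp [e]
  have hff : ∀ i, f i * f i = f i := fun i => by simp [f]
  have hef : ∀ i, e i * f i = e i := fun i => by
    simp only [e, f]; split_ifs with h1 h2 <;> simp_all
  have heB : ∀ i, e i * pderiv i B = 0 := fun i => by
    simp only [e]; split_ifs with h
    · rw [hB0 i (by simp [h])]; simp
    · simp
  have hfB : ∀ i, f i * pderiv i B = pderiv i B := fun i => by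
    simp only [f]; split_ifs with h
    · simp
    · rw [hB0 i (by lia)]; simp
  have h1 : ∀ i, pderiv i (s ^ a * z ^ b * B) =
      e i * (a * s ^ (a - 1) * z ^ b * B) + f i * (b * s ^ a * z ^ (b - 1) * B) +
        s ^ a * z ^ b * pderiv i B := fun i => by
    simp only [Derivation.leibniz, Derivation.leibniz_pow, hds, hdz, smul_eq_mul, nsmul_eq_mul]
    ring
  have h2 : ∀ i, pderiv i (pderiv i (s ^ a * z ^ b * B)) =
      e i * (a * (a - 1 : ℕ) * s ^ (a - 1 - 1) * z ^ b * B) +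
      e i * (2 * a * b * s ^ (a - 1) * z ^ (b - 1) * B) +
      f i * (b * (b - 1 : ℕ) * s ^ a * z ^ (b - 1 - 1) * B) +
      2 * b * s ^ a * z ^ (b - 1) * pderiv i B + s ^ a * z ^ b * pderiv i (pderiv i B) :=
    fun i => by
    rw [h1]
    simp only [map_add, Derivation.leibniz, Derivation.leibniz_pow, hds, hdz, hde, hdf,
      smul_eq_mul, nsmul_eq_mul, Derivation.map_natCast]
    linear_combination (a * (a - 1 : ℕ) * s ^ (a - 1 - 1) * z ^ b * B) * hee i +
      (2 * a * b * s ^ (a - 1) * z ^ (b - 1) * B) * hef i +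
      (b * (b - 1 : ℕ) * s ^ a * z ^ (b - 1 - 1) * B) * hff i +
      (2 * a * s ^ (a - 1) * z ^ b) * heB i + (2 * b * s ^ a * z ^ (b - 1)) * hfB i
  have sX : ∑ i, X i * e i = s := by simp [e, hs_def]
  have zX : ∑ i, X i * f i = z := by
    simp [f, hz_def, tailSum, tailSet, Finset.sum_filter]
  have sκ : ∑ i, C (κ i + 1) * e i = C (κ j.castSucc + 1) := by simp [e]
  have zκ : ∑ i, C (κ i + 1) * f i = C (∑ i ∈ tailSet d j, (κ i + 1)) := by
    rw [map_sum]
    simp [f, tailSet, Finset.sum_filter]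
  have hE : ∑ i, X i * pderiv i B = n * B := by rw [hB.sum_X_mul_pderiv, nsmul_eq_mul]
  rw [laguerreOp_apply] at hL ⊢
  have key : ∑ i, (X i * pderiv i (pderiv i (s ^ a * z ^ b * B)) +
        C (κ i + 1) * pderiv i (s ^ a * z ^ b * B)) =
      (∑ i, X i * e i) * (a * (a - 1 : ℕ) * s ^ (a - 1 - 1) * z ^ b * B) +
      (∑ i, X i * e i) * (2 * a * b * s ^ (a - 1) * z ^ (b - 1) * B) +
      (∑ i, X i * f i) * (b * (b - 1 : ℕ) * s ^ a * z ^ (b - 1 - 1) * B) +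
      (2 * b * s ^ a * z ^ (b - 1)) * (∑ i, X i * pderiv i B) +
      (∑ i, C (κ i + 1) * e i) * (a * s ^ (a - 1) * z ^ b * B) +
      (∑ i, C (κ i + 1) * f i) * (b * s ^ a * z ^ (b - 1) * B) +
      (s ^ a * z ^ b) * ∑ i, (X i * pderiv i (pderiv i B) + C (κ i + 1) * pderiv i B) := by
    simp only [Finset.sum_mul, Finset.mul_sum, ← Finset.sum_add_distrib]
    refine Finset.sum_congr rfl fun i _ => ?_
    rw [h2, h1]
    ring
  have ha := mul_X_pow_pred_pred a s
  have hb := mul_X_pow_pred_pred b z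
  have ha' : s * ((a : MvPolynomial (Fin (d + 1)) ℝ) * s ^ (a - 1)) = a * s ^ a := by
    rcases a with _ | a
    · simp
    · simp; ring
  rw [key, hL, sX, zX, hE, sκ, zκ]
  simp only [map_add, map_mul, map_sub, map_natCast, map_one, map_ofNat]
  linear_combination (z ^ b * B) * ha + (s ^ a * B) * hb + 2 * b * z ^ (b - 1) * B * ha'

/-- Coefficients of the Hahn and Jacobi factor attached to the coordinate `j`. -/
noncomputable def factorCoeff (κ : Fin (d + 1) → ℝ) (ν : Fin d → ℕ) (j : Fin d) (k : ℕ) : ℝ :=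
  poch (-(ν j : ℝ)) k * poch ((ν j : ℝ) + κ j.castSucc + aj d κ ν j + 1) k /
    (poch (κ j.castSucc + 1) k * (Nat.factorial k : ℝ))

/-- The homogeneous Jacobi factor attached to the coordinate `j`. -/
noncomputable def jacobiFactor (κ : Fin (d + 1) → ℝ) (ν : Fin d → ℕ) (j : Fin d) :
    MvPolynomial (Fin (d + 1)) ℝ :=
  ∑ k ∈ range (ν j + 1),
    C (factorCoeff κ ν j k) * (X j.castSucc ^ k * tailSum d j ^ (ν j - k))

theorem jacobiFactor_mem_supported (κ : Fin (d + 1) → ℝ) (ν : Fin d → ℕ) (j : Fin d) :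
    jacobiFactor κ ν j ∈ supported ℝ (tailSet d j : Set (Fin (d + 1))) :=
  Subalgebra.sum_mem _ fun _ _ => Subalgebra.mul_mem _ (Subalgebra.algebraMap_mem _ _)
    (Subalgebra.mul_mem _ (Subalgebra.pow_mem _ (X_mem_tail j) _)
      (Subalgebra.pow_mem _ (tailSum_mem_supported _) _))

theorem jacobiFactor_isHomogeneous (κ : Fin (d + 1) → ℝ) (ν : Fin d → ℕ) (j : Fin d) :
    (jacobiFactor κ ν j).IsHomogeneous (ν j) := by
  refine IsHomogeneous.sum _ _ _ fun k hk => ?_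
  have h := (isHomogeneous_C (Fin (d + 1)) (factorCoeff κ ν j k)).mul
    (((isHomogeneous_X ℝ j.castSucc).pow k).mul ((tailSum_isHomogeneous (d := d) j).pow (ν j - k)))
  have e : 0 + (1 * k + 1 * (ν j - k)) = ν j := by
    have := Finset.mem_range.1 hk; lia
  rwa [e] at h

/-- The degree carried by the coordinates with index at least `j`. -/
def tailDegree (ν : Fin d → ℕ) (j : ℕ) : ℕ := ∑ i ∈ univ.filter fun i : Fin d => j ≤ (i : ℕ), ν i

/-- The product of the Jacobi factors with index at least `j`. -/
noncomputable def tailProd (κ : Fin (d + 1) → ℝ) (ν : Fin d → ℕ) (j : ℕ) :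
    MvPolynomial (Fin (d + 1)) ℝ :=
  ∏ i ∈ univ.filter fun i : Fin d => j ≤ (i : ℕ), jacobiFactor κ ν i

theorem filter_le_eq_insert (j : Fin d) :
    (univ.filter fun i : Fin d => (j : ℕ) ≤ (i : ℕ)) =
      insert j (univ.filter fun i : Fin d => (j : ℕ) + 1 ≤ (i : ℕ)) := by
  ext i
  simp [Fin.ext_iff]
  lia

theorem tailDegree_eq_add (ν : Fin d → ℕ) (j : Fin d) :
    tailDegree ν j = ν j + tailDegree ν (j + 1) := by
  rw [tailDegree, filter_le_eq_insert, Finset.sum_insert (by simp), tailDegree]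

theorem tailProd_eq_mul (κ : Fin (d + 1) → ℝ) (ν : Fin d → ℕ) (j : Fin d) :
    tailProd κ ν j = jacobiFactor κ ν j * tailProd κ ν (j + 1) := by
  rw [tailProd, filter_le_eq_insert, Finset.prod_insert (by simp), tailProd]

theorem tailProd_isHomogeneous (κ : Fin (d + 1) → ℝ) (ν : Fin d → ℕ) (j : ℕ) :
    (tailProd κ ν j).IsHomogeneous (tailDegree ν j) :=
  IsHomogeneous.prod _ _ _ fun i _ => jacobiFactor_isHomogeneous κ ν i

theorem tailProd_mem_supported (κ : Fin (d + 1) → ℝ) (ν : Fin d → ℕ) (j : ℕ) :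
    tailProd κ ν j ∈ supported ℝ (tailSet d j : Set (Fin (d + 1))) :=
  Subalgebra.prod_mem _ fun i hi =>
    supported_mono (fun _ hk => by simp [tailSet] at hi hk ⊢; lia)
      (jacobiFactor_mem_supported κ ν i)

theorem sumGt_eq_tailDegree (ν : Fin d → ℕ) (j : Fin d) :
    sumGt d ν j = (tailDegree ν (j + 1) : ℝ) := by
  simp [sumGt, tailDegree]

theorem sum_tailSet_eq (κ : Fin (d + 1) → ℝ) (ν : Fin d → ℕ) (j : Fin d) :
    ∑ i ∈ tailSet d j, (κ i + 1) + 2 * (tailDegree ν (j + 1) : ℝ) =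
      κ j.castSucc + aj d κ ν j + 2 := by
  have hins : tailSet d j = insert j.castSucc
      (univ.filter fun i : Fin (d + 1) => (j : ℕ) < (i : ℕ)) := by
    ext i; simp [tailSet, Fin.ext_iff]; lia
  have hcard : (univ.filter fun i : Fin (d + 1) => (j : ℕ) < (i : ℕ)).card = d - j := by
    have := Fin.card_Ioi (j.castSucc)
    rw [show (univ.filter fun i : Fin (d + 1) => (j : ℕ) < (i : ℕ)) = Ioi j.castSucc by
      ext i; simp [Fin.lt_def], this]
    simp
  have hd : ((d - j : ℕ) : ℝ) = ((d - 1 - j : ℕ) : ℝ) + 1 := by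
    have := j.2
    exact_mod_cast (by lia : d - (j : ℕ) = d - 1 - j + 1)
  rw [← sumGt_eq_tailDegree, hins, Finset.sum_insert (by simp), Finset.sum_add_distrib,
    Finset.sum_const, hcard, nsmul_eq_mul, hd, aj, sumGt]
  ring

theorem factorCoeff_succ {κ : Fin (d + 1) → ℝ} (hκ : ∀ i, -1 < κ i) (ν : Fin d → ℕ) (j : Fin d)
    (k : ℕ) :
    factorCoeff κ ν j (k + 1) * ((k + 1 : ℝ) * (k + 1 + κ j.castSucc)) +
      factorCoeff κ ν j k * ((ν j - k : ℝ) * (ν j + κ j.castSucc + aj d κ ν j + 1 + k)) = 0 := by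
  have h0 : 0 < κ j.castSucc + 1 := by linarith [hκ j.castSucc]
  have h1 := (poch_pos h0 k).ne'
  have h2 : κ j.castSucc + 1 + k ≠ 0 := by positivity
  have h3 : (k.factorial : ℝ) ≠ 0 := by positivity
  have h4 : (k + 1 : ℝ) ≠ 0 := by positivity
  simp only [factorCoeff, poch_succ, Nat.factorial_succ]
  push_cast
  field_simp
  ring

theorem laguerreOp_jacobiFactor_mul {κ : Fin (d + 1) → ℝ} (hκ : ∀ i, -1 < κ i) (ν : Fin d → ℕ)
    (j : Fin d) {B : MvPolynomial (Fin (d + 1)) ℝ} (hB : B.IsHomogeneous (tailDegree ν (j + 1)))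
    (hs : B ∈ supported ℝ (tailSet d (j + 1) : Set (Fin (d + 1)))) (hL : laguerreOp κ B = 0) :
    laguerreOp κ (jacobiFactor κ ν j * B) = 0 := by
  have hterm : ∀ k ∈ range (ν j + 1),
      laguerreOp κ (C (factorCoeff κ ν j k) * (X j.castSucc ^ k * tailSum d j ^ (ν j - k)) * B) =
      C (factorCoeff κ ν j k * ((k : ℝ) * (k + κ j.castSucc))) *
          (X j.castSucc ^ (k - 1) * tailSum d j ^ (ν j - k)) * B +
        C (factorCoeff κ ν j k * ((ν j - k : ℝ) *
          (ν j + κ j.castSucc + aj d κ ν j + 1 + k))) *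
          (X j.castSucc ^ k * tailSum d j ^ (ν j - k - 1)) * B := by
    intro k hk
    have hk' : k ≤ ν j := by have := Finset.mem_range.1 hk; lia
    have h := sum_tailSet_eq κ ν j
    have e : (2 * k + ((ν j : ℝ) - k) - 1 + ∑ i ∈ tailSet d j, (κ i + 1) +
        2 * (tailDegree ν (j + 1) : ℝ)) = ν j + κ j.castSucc + aj d κ ν j + 1 + k := by
      linear_combination h
    rw [mul_assoc, ← smul_eq_C_mul, map_smul, smul_eq_C_mul,
      laguerreOp_X_pow_mul_tailSum_pow_mul κ j hB hs hL, Nat.cast_sub hk', e]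
    simp only [map_mul]
    ring
  rw [jacobiFactor, Finset.sum_mul, map_sum, Finset.sum_congr rfl hterm, Finset.sum_add_distrib,
    Finset.sum_range_succ', Finset.sum_range_succ (n := ν j)]
  simp only [Nat.cast_zero, zero_mul, mul_zero, map_zero, add_zero, sub_self, add_tsub_cancel_right]
  rw [← Finset.sum_add_distrib]
  refine Finset.sum_eq_zero fun k _ => ?_
  rw [← Nat.sub_sub, ← add_mul, ← add_mul, ← map_add]
  push_cast
  rw [factorCoeff_succ hκ]
  simp

theorem laguerreOp_tailProd {κ : Fin (d + 1) → ℝ} (hκ : ∀ i, -1 < κ i) (ν : Fin d → ℕ) {j : ℕ}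
    (hj : j ≤ d) : laguerreOp κ (tailProd κ ν j) = 0 := by
  induction hj using Nat.decreasingInduction with
  | self =>
    have : (univ.filter fun i : Fin d => d ≤ (i : ℕ)) = ∅ := by ext i; simp
    simp [tailProd, this, laguerreOp_apply]
  | of_succ j hj ih =>
    rw [tailProd_eq_mul κ ν ⟨j, hj⟩]
    exact laguerreOp_jacobiFactor_mul hκ ν ⟨j, hj⟩ (tailProd_isHomogeneous κ ν _)
      (tailProd_mem_supported κ ν _) ih

/-- The factor of the Hahn polynomial attached to `j`, cleared of denominators in `x`. -/
noncomputable def hahnFactor (κ : Fin (d + 1) → ℝ) (ν : Fin d → ℕ) (y : ℝ) (M : ℝ) (j : Fin d) :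
    ℝ :=
  ∑ k ∈ range (ν j + 1), factorCoeff κ ν j k * (poch (-y) k * poch (-M + k) (ν j - k))

theorem umbral_jacobiFactor_mul (κ : Fin (d + 1) → ℝ) (ν : Fin d → ℕ) (x : Fin (d + 1) → ℝ)
    (j : Fin d) {B : MvPolynomial (Fin (d + 1)) ℝ} {n : ℕ} (hB : B.IsHomogeneous n)
    (hs : B ∈ supported ℝ (tailSet d (j + 1) : Set (Fin (d + 1)))) :
    umbral x (jacobiFactor κ ν j * B) =
      hahnFactor κ ν (x j.castSucc) ((∑ i ∈ tailSet d j, x i) - n) j * umbral x B := by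
  rw [jacobiFactor, Finset.sum_mul, map_sum, hahnFactor, Finset.sum_mul]
  refine Finset.sum_congr rfl fun k _ => ?_
  have hs' : B ∈ supported ℝ (tailSet d j : Set (Fin (d + 1))) :=
    supported_mono (fun _ hk => by simp [tailSet] at hk ⊢; lia) hs
  have hj : j.castSucc ∉ B.vars := fun h => by
    have := mem_supported.1 hs h
    simp [tailSet] at this
  have e : C (factorCoeff κ ν j k) * (X j.castSucc ^ k * tailSum d j ^ (ν j - k)) * B =
      factorCoeff κ ν j k • ((∑ i ∈ tailSet d j, X i) ^ (ν j - k) * (X j.castSucc ^ k * B)) := by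
    rw [smul_eq_C_mul, tailSum]; ring
  rw [e, map_smul, umbral_sum_X_pow_mul x
    (Subalgebra.mul_mem _ (Subalgebra.pow_mem _ (X_mem_tail j) k) hs')
    (((isHomogeneous_X ℝ j.castSucc).pow k).mul hB), umbral_X_pow_mul x hj, smul_eq_mul]
  push_cast
  rw [show (1 * (k : ℝ) + n - ∑ i ∈ tailSet d j, x i) =
    -(∑ i ∈ tailSet d j, x i - n) + k by ring]
  ring

theorem umbral_tailProd (κ : Fin (d + 1) → ℝ) (ν : Fin d → ℕ) (x : Fin (d + 1) → ℝ) {j : ℕ}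
    (hj : j ≤ d) :
    umbral x (tailProd κ ν j) = ∏ i ∈ univ.filter fun i : Fin d => j ≤ (i : ℕ),
      hahnFactor κ ν (x i.castSucc) ((∑ l ∈ tailSet d i, x l) - tailDegree ν (i + 1)) i := by
  induction hj using Nat.decreasingInduction with
  | self =>
    have : (univ.filter fun i : Fin d => d ≤ (i : ℕ)) = ∅ := by ext i; simp
    simp [tailProd, this, umbral_one]
  | of_succ j hj ih =>
    rw [tailProd_eq_mul κ ν ⟨j, hj⟩, umbral_jacobiFactor_mul κ ν x ⟨j, hj⟩
      (tailProd_isHomogeneous κ ν _) (tailProd_mem_supported κ ν _), ih,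
      filter_le_eq_insert ⟨j, hj⟩, Finset.prod_insert (by simp)]

end Harmonic

section Expansion

open MvPolynomial

variable {d : ℕ}

theorem mem_ZN {n : ℕ} {α : Fin (d + 1) → ℕ} : α ∈ ZN d n ↔ ∑ i, α i = n := by
  simp only [ZN, Finset.mem_filter, Fintype.mem_piFinset, Finset.mem_range, and_iff_right_iff_imp]
  rintro rfl i
  exact Nat.lt_succ_of_le (Finset.single_le_sum (f := α) (fun _ _ => Nat.zero_le _) (mem_univ i))

theorem exists_lt_of_sum_le {α β : Fin (d + 1) → ℕ} (h : ∑ i, α i ≤ ∑ i, β i) (hne : β ≠ α) :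
    ∃ i, α i < β i := by
  by_contra! hle
  refine hne (funext fun i => ?_)
  have := (Finset.sum_eq_sum_iff_of_le fun i _ => hle i).1
    (le_antisymm (Finset.sum_le_sum fun i _ => hle i) h)
  exact this i (mem_univ i)

theorem monomialFunctional_eq_sum {n : ℕ} (v : (Fin (d + 1) →₀ ℕ) → ℝ)
    {P : MvPolynomial (Fin (d + 1)) ℝ} (hP : P.IsHomogeneous n) :
    monomialFunctional v P = ∑ α ∈ ZN d n,
      coeff (Finsupp.equivFunOnFinite.symm α) P * v (Finsupp.equivFunOnFinite.symm α) := by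
  have h := linearMap_eq_of_support (P := P) (φ := monomialFunctional v)
    (ψ := ∑ α ∈ ZN d n,
      v (Finsupp.equivFunOnFinite.symm α) • lcoeff ℝ (Finsupp.equivFunOnFinite.symm α))
    fun γ hγ => by
      rw [monomialFunctional_monomial, LinearMap.sum_apply,
        Finset.sum_eq_single (γ : Fin (d + 1) → ℕ)]
      · simp [lcoeff]
      · intro β _ hβ
        have : γ ≠ Finsupp.equivFunOnFinite.symm β := fun h => hβ (by rw [h]; rfl)
        simp [lcoeff, coeff_monomial, this]
      · exact fun h => absurd (mem_ZN.2 (sum_eq_of_mem_support hP hγ)) h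
  rw [h, LinearMap.sum_apply]
  simp [lcoeff, mul_comm]

theorem sum_ZN_mul_pochV_neg {n : ℕ} (c : (Fin (d + 1) → ℕ) → ℝ) {γ : Fin (d + 1) → ℕ}
    (hγ : γ ∈ ZN d n) :
    ∑ α ∈ ZN d n, c α * pochV (fun i => -(α i : ℝ)) γ = c γ * ((-1) ^ n * mfact γ) := by
  rw [Finset.sum_eq_single γ, pochV_neg_natCast_self, mem_ZN.1 hγ]
  · intro α hα hne
    obtain ⟨i, hi⟩ := exists_lt_of_sum_le (mem_ZN.1 hα ▸ (mem_ZN.1 hγ).ge) hne.symm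
    rw [pochV_neg_natCast_eq_zero hi, mul_zero]
  · exact fun h => absurd hγ h

theorem umbral_natCast {n : ℕ} {P : MvPolynomial (Fin (d + 1)) ℝ} (hP : P.IsHomogeneous n)
    {α : Fin (d + 1) → ℕ} (hα : α ∈ ZN d n) :
    umbral (fun i => (α i : ℝ)) P =
      coeff (Finsupp.equivFunOnFinite.symm α) P * ((-1) ^ n * mfact α) := by
  rw [umbral, monomialFunctional_eq_sum _ hP, Finset.sum_eq_single α]
  · simp [pochV_neg_natCast_self, mem_ZN.1 hα]
  · intro β hβ hne
    obtain ⟨i, hi⟩ := exists_lt_of_sum_le (mem_ZN.1 hα ▸ (mem_ZN.1 hβ).ge) hne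
    rw [pochV_neg_natCast_eq_zero (i := i) (by simpa using hi), mul_zero]
  · exact fun h => absurd hα h

theorem mfact_ne_zero {m : ℕ} (γ : Fin m → ℕ) : mfact γ ≠ 0 :=
  Finset.prod_ne_zero_iff.2 fun _ _ => by positivity

theorem monicQ_eq_sum_box (N : ℕ) (κ : Fin (d + 1) → ℝ) {n : ℕ} {α : Fin (d + 1) → ℕ}
    (hα : α ∈ ZN d n) (x : Fin (d + 1) → ℝ) :
    monicQ d N κ α x = ∑ γ ∈ Fintype.piFinset fun _ => range (n + 1),
      poch (-(N : ℝ)) n / poch ((∑ i, κ i) + d + n) n *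
        (poch ((∑ i, κ i) + d + n) (∑ i, γ i) * pochV (fun i => -(x i)) γ /
          (mfact γ * pochV (fun i => κ i + 1) γ * poch (-(N : ℝ)) (∑ i, γ i))) *
        (pochV (fun i => κ i + 1) α * pochV (fun i => -(α i : ℝ)) γ) := by
  rw [monicQ, mem_ZN.1 hα]
  have hn : ∀ i, α i ≤ n := fun i => by
    rw [← mem_ZN.1 hα]
    exact Finset.single_le_sum (f := α) (fun _ _ => Nat.zero_le _) (mem_univ i)
  have hcast : (∑ i, (α i : ℝ)) = n := by rw [← mem_ZN.1 hα, Nat.cast_sum]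
  rw [Finset.mul_sum]
  refine Finset.sum_subset_zero_on_sdiff
    (Fintype.piFinset_subset _ _ fun i => Finset.range_subset_range.2 (by have := hn i; lia)) ?_ ?_
  · intro γ hγ
    obtain ⟨i, hi⟩ : ∃ i, α i < γ i := by
      by_contra! h
      exact (Finset.mem_sdiff.1 hγ).2
        (Fintype.mem_piFinset.2 fun i => Finset.mem_range.2 (Nat.lt_succ_of_le (h i)))
    rw [pochV_neg_natCast_eq_zero hi]
    simp
  · intro γ _
    have hs : ((-1 : ℝ) ^ (∑ i, γ i)) * (-1 : ℝ) ^ (∑ i, γ i) = 1 := by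
      rw [← mul_pow]; simp
    rw [mono]
    simp only [div_eq_mul_inv]
    linear_combination (poch (-(N : ℝ)) n * pochV (fun i => κ i + 1) α *
      (poch ((∑ i, κ i) + d + n) n)⁻¹ * pochV (fun i => -(α i : ℝ)) γ *
      poch ((∑ i, κ i) + d + n) (∑ i, γ i) *
      (mfact γ * pochV (fun i => κ i + 1) γ * poch (-(N : ℝ)) (∑ i, γ i))⁻¹ *
      pochV (fun i => -(x i)) γ) * hs

theorem sum_coeff_mul_monicQ {N n : ℕ} (hnN : n ≤ N) {κ : Fin (d + 1) → ℝ} (hκ : ∀ i, -1 < κ i)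
    {P : MvPolynomial (Fin (d + 1)) ℝ} (hP : P.IsHomogeneous n) (hL : laguerreOp κ P = 0)
    (x : Fin (d + 1) → ℝ) :
    ∑ α ∈ ZN d n, coeff (Finsupp.equivFunOnFinite.symm α) P * monicQ d N κ α x =
      (-1) ^ n * umbral x P := by
  have hμ : poch ((∑ i, κ i) + d + n) n ≠ 0 := by
    rcases Nat.eq_zero_or_pos n with rfl | hn
    · simp [poch]
    · refine (poch_pos ?_ n).ne'
      have h1 : ∑ _i : Fin (d + 1), (-1 : ℝ) < ∑ i, κ i :=
        Finset.sum_lt_sum_of_nonempty univ_nonempty fun i _ => hκ i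
      have h2 : (1 : ℝ) ≤ n := by exact_mod_cast hn
      simp at h1
      linarith
  have hN := poch_neg_natCast_ne_zero hnN
  have hW : ∀ γ : Fin (d + 1) → ℕ, weightFunctional κ γ P = ∑ α ∈ ZN d n,
      coeff (Finsupp.equivFunOnFinite.symm α) P * pochV (fun i => κ i + 1) α *
        pochV (fun i => -(α i : ℝ)) γ := fun γ => by
    rw [weightFunctional, monomialFunctional_eq_sum _ hP]
    simp [mul_assoc]
  have hW0 : ∀ γ : Fin (d + 1) → ℕ, ∑ i, γ i ≠ n → weightFunctional κ γ P = 0 := by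
    intro γ hγ
    have h := weightFunctional_laguerreOp κ γ hP
    rw [hL, map_zero, eq_comm, mul_eq_zero, sub_eq_zero] at h
    exact h.resolve_left fun h => hγ (by exact_mod_cast h.symm)
  rw [umbral, monomialFunctional_eq_sum _ hP, Finset.mul_sum,
    Finset.sum_congr rfl fun α hα => by rw [monicQ_eq_sum_box N κ hα x, Finset.mul_sum],
    Finset.sum_comm, ZN, Finset.sum_filter]
  refine Finset.sum_congr rfl fun γ hγ => ?_
  have hpull : ∀ a b : ℝ, ∑ α ∈ ZN d n, coeff (Finsupp.equivFunOnFinite.symm α) P *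
      (a * b * (pochV (fun i => κ i + 1) α * pochV (fun i => -(α i : ℝ)) γ)) =
      a * b * weightFunctional κ γ P := fun a b => by
    rw [hW, Finset.mul_sum]
    exact Finset.sum_congr rfl fun _ _ => by ring
  rw [← ZN, hpull]
  split_ifs with h
  · rw [hW, sum_ZN_mul_pochV_neg (fun α => coeff (Finsupp.equivFunOnFinite.symm α) P *
      pochV (fun i => κ i + 1) α) (mem_ZN.2 h), h]
    have hm := mfact_ne_zero γ
    have hp : pochV (fun i => κ i + 1) γ ≠ 0 :=
      Finset.prod_ne_zero_iff.2 fun i _ => (poch_pos (by linarith [hκ i]) _).ne'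
    simp only [Finsupp.coe_equivFunOnFinite_symm]
    field_simp
  · rw [hW0 γ h, mul_zero]

theorem poch_mul_hahn1_eq_hahnFactor {κ : Fin (d + 1) → ℝ} (ν : Fin d → ℕ) (y : ℝ) {j : Fin d}
    {M : ℕ} (h : ν j ≤ M) :
    poch (-(M : ℝ)) (ν j) * hahn1 (ν j) y (κ j.castSucc) (aj d κ ν j) M =
      hahnFactor κ ν y M j := by
  rw [hahn1, hahnFactor, Finset.mul_sum]
  refine Finset.sum_congr rfl fun k hk => ?_
  have hk' : k ≤ ν j := by have := Finset.mem_range.1 hk; lia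
  have h0 : poch (-(M : ℝ)) k ≠ 0 := poch_neg_natCast_ne_zero (hk'.trans h)
  have hadd : poch (-(M : ℝ)) (ν j) = poch (-(M : ℝ)) k * poch (-(M : ℝ) + k) (ν j - k) := by
    rw [← poch_add, Nat.add_sub_cancel' hk']
  have hinv := mul_inv_cancel₀ h0
  rw [hadd, factorCoeff]
  simp only [div_eq_mul_inv, mul_inv]
  linear_combination (poch (-(M : ℝ) + k) (ν j - k) * poch (-(ν j : ℝ)) k *
    poch ((ν j : ℝ) + κ j.castSucc + aj d κ ν j + 1) k * poch (-y) k *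
    (poch (κ j.castSucc + 1) k)⁻¹ * (k.factorial : ℝ)⁻¹) * hinv

theorem hahnFactor_eq_zero {κ : Fin (d + 1) → ℝ} {ν : Fin d → ℕ} {j : Fin d} {y M : ℕ}
    (hy : y ≤ M) (hM : M < ν j) : hahnFactor κ ν y M j = 0 := by
  refine Finset.sum_eq_zero fun k _ => ?_
  rcases Nat.lt_or_ge y k with h | h
  · rw [poch_neg_natCast_eq_zero h]; ring
  · have e : -(M : ℝ) + k = -((M - k : ℕ) : ℝ) := by
      rw [Nat.cast_sub (h.trans hy)]; ring
    rw [e, poch_neg_natCast_eq_zero (b := M - k) (k := ν j - k) (by lia)]; ring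

theorem sum_tailSet_eq_add (x : Fin (d + 1) → ℕ) (j : Fin d) :
    ∑ i ∈ tailSet d j, x i = x j.castSucc + ∑ i ∈ tailSet d (j + 1), x i := by
  have : tailSet d j = insert j.castSucc (tailSet d (j + 1)) := by
    ext i; simp [tailSet, Fin.ext_iff]; lia
  rw [this, Finset.sum_insert (by simp [tailSet])]

theorem sumLt_add_sum_tailSet {N : ℕ} {x : Fin (d + 1) → ℕ} (hx : x ∈ ZN d N) (j : Fin d) :
    sumLt d x j + ∑ i ∈ tailSet d j, (x i : ℝ) = N := by
  rw [← mem_ZN.1 hx, sumLt, tailSet, Nat.cast_sum,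
    ← Finset.sum_filter_add_sum_filter_not univ (fun i : Fin (d + 1) => (i : ℕ) < (j : ℕ))]
  simp

theorem prod_poch_mul_hahn1_eq {N : ℕ} (κ : Fin (d + 1) → ℝ) (ν : Fin d → ℕ)
    {x : Fin (d + 1) → ℕ} (hx : x ∈ ZN d N) :
    ∏ j : Fin d, (poch (-(N : ℝ) + sumLt d x j + sumGt d ν j) (ν j) *
        hahn1 (ν j) (x j.castSucc : ℝ) (κ j.castSucc) (aj d κ ν j)
          ((N : ℝ) - sumLt d x j - sumGt d ν j)) =
      umbral (fun i => (x i : ℝ)) (tailProd κ ν 0) := by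
  rw [umbral_tailProd κ ν _ (Nat.zero_le d)]
  simp only [Nat.zero_le, Finset.filter_true]
  have hM : ∀ j : Fin d, tailDegree ν (j + 1) ≤ ∑ i ∈ tailSet d (j + 1), x i →
      ∃ M : ℕ, M + tailDegree ν (j + 1) = ∑ i ∈ tailSet d j, x i ∧ x j.castSucc ≤ M ∧
        (N : ℝ) - sumLt d x j - sumGt d ν j = M ∧
        -(N : ℝ) + sumLt d x j + sumGt d ν j = -M ∧
        (∑ i ∈ tailSet d j, (x i : ℝ)) - tailDegree ν (j + 1) = M := by
    intro j hj
    have h1 := sum_tailSet_eq_add x j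
    have h2 := sumLt_add_sum_tailSet hx j
    obtain ⟨M, hM⟩ : ∃ M : ℕ, M + tailDegree ν (j + 1) = ∑ i ∈ tailSet d j, x i :=
      ⟨_, Nat.sub_add_cancel (by lia)⟩
    have h3 : (M : ℝ) + tailDegree ν (j + 1) = ∑ i ∈ tailSet d j, (x i : ℝ) := by
      exact_mod_cast hM
    rw [sumGt_eq_tailDegree]
    refine ⟨M, hM, by lia, ?_, ?_, ?_⟩ <;> linarith
  by_cases hstep : ∀ j : Fin d, tailDegree ν (j + 1) ≤ ∑ i ∈ tailSet d (j + 1), x i →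
      tailDegree ν j ≤ ∑ i ∈ tailSet d j, x i
  · have hall : ∀ j ≤ d, tailDegree ν j ≤ ∑ i ∈ tailSet d j, x i := by
      intro j hj
      induction hj using Nat.decreasingInduction with
      | self =>
        have : (univ.filter fun i : Fin d => d ≤ (i : ℕ)) = ∅ := by ext i; simp
        simp [tailDegree, this]
      | of_succ j hj ih => exact hstep ⟨j, hj⟩ ih
    refine Finset.prod_congr rfl fun j _ => ?_
    obtain ⟨M, hM1, -, e1, e2, e3⟩ := hM j (hall _ j.2)
    have h1 := hall j j.2.le
    rw [tailDegree_eq_add] at h1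
    rw [e1, e2, e3]
    exact poch_mul_hahn1_eq_hahnFactor ν _ (by lia)
  · push Not at hstep
    obtain ⟨j, hj, hlt⟩ := hstep
    obtain ⟨M, hM1, hM2, e1, e2, e3⟩ := hM j hj
    rw [tailDegree_eq_add] at hlt
    have hMν : M < ν j := by lia
    rw [Finset.prod_eq_zero (mem_univ j), Finset.prod_eq_zero (mem_univ j)]
    · rw [e3]; exact hahnFactor_eq_zero hM2 hMν
    · rw [e2, poch_neg_natCast_eq_zero hMν, zero_mul]

theorem hahnH_eq_umbral {N : ℕ} (κ : Fin (d + 1) → ℝ) (ν : Fin d → ℕ)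
    {x : Fin (d + 1) → ℕ} (hx : x ∈ ZN d N) :
    hahnH d N κ ν x = (-1 : ℝ) ^ (∑ i, ν i) / poch (-(N : ℝ)) (∑ i, ν i) *
      ((∏ j : Fin d, poch (κ j.castSucc + 1) (ν j) / poch (aj d κ ν j + 1) (ν j)) *
        umbral (fun i => (x i : ℝ)) (tailProd κ ν 0)) := by
  rw [hahnH, ← prod_poch_mul_hahn1_eq κ ν hx, ← Finset.prod_mul_distrib]
  simp only [mul_assoc]

end Expansion

/-- expansion of the Hahn polynomial `H_ν` in monic Hahn polynomials. -/
theorem hahn_eq_sum_monicHahn (d N n : ℕ) (hd : 1 ≤ d) (κ : Fin (d + 1) → ℝ)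
    (hκ : ∀ i, -1 < κ i) (hnN : n ≤ N) (ν : Fin d → ℕ) (hν : ∑ i, ν i = n)
    (x : Fin (d + 1) → ℕ) (hx : x ∈ ZN d N) :
    hahnH d N κ ν x =
      (-1 : ℝ) ^ n * (Nat.factorial n : ℝ) / poch (-(N : ℝ)) n *
        ∑ α ∈ ZN d n, hahnH d n κ ν α / mfact α * monicQ d N κ α (fun i => (x i : ℝ)) := by
  have hdeg : tailDegree ν 0 = n := by simpa [tailDegree] using hν
  have hP : (tailProd κ ν 0).IsHomogeneous n := hdeg ▸ tailProd_isHomogeneous κ ν 0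
  have hsum := sum_coeff_mul_monicQ hnN hκ hP (laguerreOp_tailProd hκ ν (Nat.zero_le d))
    (fun i => (x i : ℝ))
  set K : ℝ := ∏ j : Fin d, poch (κ j.castSucc + 1) (ν j) / poch (aj d κ ν j + 1) (ν j)
    with hK
  have hs : (-1 : ℝ) ^ n * (-1 : ℝ) ^ n = 1 := by rw [← mul_pow]; simp
  have hf : (n.factorial : ℝ) ≠ 0 := by positivity
  have hterm : ∀ α ∈ ZN d n, hahnH d n κ ν α / mfact α * monicQ d N κ α (fun i => (x i : ℝ)) =
      (-1) ^ n * K / n.factorial * (MvPolynomial.coeff (Finsupp.equivFunOnFinite.symm α)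
        (tailProd κ ν 0) * monicQ d N κ α (fun i => (x i : ℝ))) := by
    intro α hα
    have hm := mfact_ne_zero α
    rw [hahnH_eq_umbral κ ν hα, umbral_natCast hP hα, hν, poch_neg_natCast_self, ← hK]
    field_simp
  rw [Finset.sum_congr rfl hterm, ← Finset.mul_sum, hsum, hahnH_eq_umbral κ ν hx, hν, ← hK]
  have hN := poch_neg_natCast_ne_zero hnN
  field_simp
  linear_combination (-(K * umbral (fun i => (x i : ℝ)) (tailProd κ ν 0))) * hs
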